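/- arXiv:2604.25970 — 2 statements merged into one kernel-verified Lean document; each statement's English description precedes it below -/
import Mathlib

section
/- (Right edge rate, type A / Λ case.) For each m ≥ 1 let A_m(z) = ∑_{k=0}^{m−1} ⟨m, k⟩ z^k be the Eulerian polynomial of type A, where ⟨m, k⟩ is the number of permutations of {0, …, m−1} with exactly k descents. Suppose that for each n ≥ 2 there exists a_n > 0 with A_{2n}(−a_n) = 0, a_n ≤ a for every a > 0 with A_{2n}(−a) = 0, and such that every complex root of A_{2n} is a negative real number. Define x_n := ((1 − a_n)/(1 + a_n))². Then (1/(n−1)) · log(1 − x_n) → −log 4 as n → ∞. -/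
open Polynomial Filter

open scoped Classical in
/-- The Eulerian polynomial of type A: `A_m(z) = ∑_{k=0}^{m−1} ⟨m,k⟩ z^k`, where
`⟨m,k⟩` counts permutations of `Fin m` with exactly `k` descents (indices `i` with
`i+1 < m` and `σ i > σ (i+1)`). -/
noncomputable def eulerianA (m : ℕ) : Polynomial ℝ :=
  ∑ k ∈ Finset.range m,
    Polynomial.C
      ((Finset.univ.filter (fun σ : Equiv.Perm (Fin m) =>
        (Finset.univ.filter (fun i : Fin m =>
          ∃ h : (i : ℕ) + 1 < m, σ ⟨(i : ℕ) + 1, h⟩ < σ i)).card = k)).card : ℝ) *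
      Polynomial.X ^ k

open scoped Classical in
/-- The descents of a permutation of `Fin m`. -/
noncomputable def descents {m : ℕ} (σ : Equiv.Perm (Fin m)) : Finset (Fin m) :=
  Finset.univ.filter (fun i : Fin m =>
    ∃ h : (i : ℕ) + 1 < m, σ ⟨(i : ℕ) + 1, h⟩ < σ i)

lemma mem_descents {m : ℕ} {σ : Equiv.Perm (Fin m)} {i : Fin m} :
    i ∈ descents σ ↔ ∃ h : (i : ℕ) + 1 < m, σ ⟨(i : ℕ) + 1, h⟩ < σ i := by
  simp [descents]

/-- The number of permutations of `Fin m` with exactly `k` descents. -/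
noncomputable def eulerianCount (m k : ℕ) : ℕ :=
  (Finset.univ.filter fun σ : Equiv.Perm (Fin m) => (descents σ).card = k).card

lemma coeff_eulerianA {m k : ℕ} (hk : k < m) :
    (eulerianA m).coeff k = eulerianCount m k := by
  simp only [eulerianA, finsetSum_coeff, coeff_C_mul_X_pow]
  rw [Finset.sum_eq_single k]
  · simp only [if_true, eulerianCount, descents]
    congr!
  · intro b _ hb
    simp [hb.symm]
  · simp [hk]

lemma natDegree_eulerianA_le (m : ℕ) : (eulerianA m).natDegree ≤ m := by
  refine natDegree_sum_le_of_forall_le _ _ fun k hk => ?_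
  exact (natDegree_C_mul_X_pow_le _ _).trans (Finset.mem_range.1 hk).le

lemma apply_lt_apply_of_forall_notMem_descents {m : ℕ} {σ : Equiv.Perm (Fin m)} {i j : Fin m}
    (hij : i < j) (h : ∀ k, i ≤ k → k < j → k ∉ descents σ) : σ i < σ j := by
  obtain ⟨j, hj⟩ := j
  have key : ∀ l : ℕ, (i : ℕ) + 1 ≤ l → ∀ hl : l < m,
      (∀ k, i ≤ k → (k : ℕ) < l → k ∉ descents σ) → σ i < σ ⟨l, hl⟩ := by
    have step : ∀ l : ℕ, ∀ hl : l + 1 < m, (⟨l, by omega⟩ : Fin m) ∉ descents σ →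
        σ ⟨l, by omega⟩ < σ ⟨l + 1, hl⟩ := by
      intro l hl hd
      rw [mem_descents] at hd
      push Not at hd
      refine lt_of_le_of_ne (hd hl) fun he => ?_
      simpa using σ.injective he
    intro l hl
    induction l, hl using Nat.le_induction with
    | base => exact fun hl hd => step i hl (hd _ le_rfl (by simp))
    | succ l hl ih =>
      intro hl' hd
      refine (ih (by omega) fun k h1 h2 => hd k h1 (by omega)).trans (step l hl' (hd _ ?_ (by simp)))
      rw [Fin.le_def]
      simp only
      omega
  exact key j hij hj fun k h1 h2 => h k h1 h2

lemma perm_eq_one_of_strictMono {m : ℕ} {σ : Equiv.Perm (Fin m)} (h : StrictMono σ) : σ = 1 := by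
  have := Subsingleton.elim (h.orderIsoOfSurjective σ σ.surjective) (OrderIso.refl (Fin m))
  ext i
  simpa using congrArg Fin.val (DFunLike.congr_fun this i)

lemma descents_eq_empty_iff {m : ℕ} {σ : Equiv.Perm (Fin m)} : descents σ = ∅ ↔ σ = 1 := by
  constructor
  · intro h
    exact perm_eq_one_of_strictMono fun i j hij =>
      apply_lt_apply_of_forall_notMem_descents hij (by simp [h])
  · rintro rfl
    ext i
    simp [mem_descents, Fin.lt_def]

lemma eulerianCount_zero_right (m : ℕ) : eulerianCount m 0 = 1 := by
  simp only [eulerianCount, Finset.card_eq_zero, descents_eq_empty_iff]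
  exact Finset.card_eq_one.2 ⟨1, by ext; simp⟩

lemma eq_of_descents_eq_singleton {m : ℕ} {σ τ : Equiv.Perm (Fin m)} {d : Fin m}
    (hσ : descents σ = {d}) (hτ : descents τ = {d})
    (h : (Finset.Iic d).image σ = (Finset.Iic d).image τ) : σ = τ := by
  have mono : ∀ {ρ : Equiv.Perm (Fin m)}, descents ρ = {d} → ∀ {i j : Fin m}, i < j →
      (i ≤ d ↔ j ≤ d) → ρ i < ρ j := by
    intro ρ hρ i j hij hd
    refine apply_lt_apply_of_forall_notMem_descents hij fun k h1 h2 hk => ?_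
    rw [hρ, Finset.mem_singleton] at hk
    subst hk
    exact absurd (hd.1 h1) (not_le.2 h2)
  have mem : ∀ i, (τ⁻¹ * σ) i ≤ d ↔ i ≤ d := by
    intro i
    have := congrArg (σ i ∈ ·) h
    simp only [Finset.mem_image, Finset.mem_Iic, eq_iff_iff, EmbeddingLike.apply_eq_iff_eq,
      exists_eq_right] at this
    rw [this, Equiv.Perm.mul_apply]
    constructor
    · exact fun hi => ⟨_, hi, by simp⟩
    · rintro ⟨k, hk, e⟩
      simpa [← e] using hk
  have : τ⁻¹ * σ = 1 := by
    refine perm_eq_one_of_strictMono fun i j hij => ?_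
    by_cases hd : i ≤ d ↔ j ≤ d
    · by_contra! hle
      rcases hle.eq_or_lt with he | hlt
      · exact hij.ne' ((τ⁻¹ * σ).injective he)
      · have := mono hτ hlt (by rw [mem, mem, hd])
        have hτσ : ∀ k, τ ((τ⁻¹ * σ) k) = σ k := by simp
        rw [hτσ, hτσ] at this
        exact (this.trans (mono hσ hij hd)).false
    · have h1 : i ≤ d ∧ ¬ j ≤ d := by
        by_cases hj : j ≤ d
        · exact absurd ⟨fun _ => hj, fun _ => hij.le.trans hj⟩ hd
        · exact ⟨by tauto, hj⟩
      rw [← mem i, ← mem j] at h1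
      exact h1.1.trans_lt (not_le.1 h1.2)
  exact (inv_mul_eq_one.1 this).symm

lemma eulerianCount_one_le (m : ℕ) : eulerianCount m 1 ≤ m * 2 ^ m := by
  classical
  have hsub : (Finset.univ.filter fun σ : Equiv.Perm (Fin m) => (descents σ).card = 1) ⊆
      Finset.univ.biUnion fun d : Fin m => Finset.univ.filter fun σ => descents σ = {d} := by
    intro σ
    simp [Finset.card_eq_one]
  refine (Finset.card_le_card hsub).trans
    ((Finset.card_biUnion_le_card_mul _ _ (2 ^ m) fun d _ => ?_).trans (by simp))
  have hcard : (Finset.univ : Finset (Finset (Fin m))).card = 2 ^ m := by simp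
  rw [← hcard]
  refine Finset.card_le_card_of_injOn (fun σ => (Finset.Iic d).image σ) (by simp) ?_
  intro σ hσ τ hτ h
  exact eq_of_descents_eq_singleton (by simpa using hσ) (by simpa using hτ) h

lemma choose_le_eulerianCount (k l : ℕ) :
    (k + l).choose k ≤ eulerianCount (k + l) 0 + eulerianCount (k + l) 1 := by
  classical
  have hdisj : Disjoint
      (Finset.univ.filter fun σ : Equiv.Perm (Fin (k + l)) => (descents σ).card = 0)
      (Finset.univ.filter fun σ : Equiv.Perm (Fin (k + l)) => (descents σ).card = 1) := by
    rw [Finset.disjoint_filter]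
    omega
  rw [eulerianCount, eulerianCount, ← Finset.card_union_of_disjoint hdisj]
  have hc : (Finset.powersetCard k (Finset.univ : Finset (Fin (k + l)))).card
      = (k + l).choose k := by simp
  rw [← hc]
  refine Finset.card_le_card_of_surjOn
    (fun σ => Finset.univ.image fun i : Fin k => σ (Fin.castAdd l i)) ?_
  intro s hs
  have hs : s.card = k := by simpa using hs
  have hs' : sᶜ.card = l := by rw [Finset.card_compl, hs]; simp
  let σ : Equiv.Perm (Fin (k + l)) := finSumFinEquiv.symm.trans (finSumEquivOfFinset hs hs')
  have hl : ∀ i, σ (Fin.castAdd l i) = s.orderEmbOfFin hs i := by intro i; simp [σ]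
  have hr : ∀ i, σ (Fin.natAdd k i) = sᶜ.orderEmbOfFin hs' i := by intro i; simp [σ]
  refine ⟨σ, ?_, ?_⟩
  · have : (descents σ).card ≤ 1 := by
      rw [Finset.card_le_one]
      have key : ∀ i ∈ descents σ, (i : ℕ) + 1 = k := by
        intro i hi
        obtain ⟨h, hlt⟩ := mem_descents.1 hi
        by_contra hne
        refine hlt.not_ge ?_
        rcases lt_or_gt_of_ne hne with hlt' | hgt
        · have e1 : i = Fin.castAdd l ⟨i, by omega⟩ := rfl
          have e2 : (⟨i + 1, h⟩ : Fin (k + l)) = Fin.castAdd l ⟨i + 1, hlt'⟩ := rfl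
          rw [e2, hl]
          conv_lhs => rw [e1, hl]
          simp [Fin.le_def]
        · have e1 : i = Fin.natAdd k ⟨i - k, by omega⟩ := by ext; simp; omega
          have e2 : (⟨i + 1, h⟩ : Fin (k + l)) = Fin.natAdd k ⟨i + 1 - k, by omega⟩ := by
            ext; simp; omega
          rw [e2, hr]
          conv_lhs => rw [e1, hr]
          simp [Fin.le_def]
          omega
      intro i hi j hj
      have := key i hi
      have := key j hj
      ext
      omega
    simp only [Finset.coe_union, Finset.coe_filter, Finset.mem_univ, true_and, Set.mem_union,
      Set.mem_ofPred_eq]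
    omega
  · simp [hl]

lemma one_div_le_coeff_one_and_coeff_one_le {p : ℝ[X]} (h0 : p.coeff 0 = 1)
    (hneg : ∀ z : ℂ, (p.map (algebraMap ℝ ℂ)).IsRoot z → ∃ r : ℝ, r < 0 ∧ z = (r : ℂ))
    {a : ℝ} (ha : 0 < a) (hroot : p.eval (-a) = 0)
    (hmin : ∀ b : ℝ, 0 < b → p.eval (-b) = 0 → a ≤ b) :
    1 / a ≤ p.coeff 1 ∧ p.coeff 1 ≤ p.natDegree * (1 / a) := by
  set q := p.map (algebraMap ℝ ℂ) with hq
  have hq0 : q.eval 0 = 1 := by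
    rw [← coeff_zero_eq_eval_zero, coeff_map, h0, map_one]
  have hqne : q ≠ 0 := by
    intro h
    simp [h] at hq0
  have hsplits : q.Splits := IsAlgClosed.splits q
  have hsum := hsplits.eval_derivative_div_eval_of_ne_zero (x := 0) (by simp [hq0])
  rw [hq0, div_one, ← coeff_zero_eq_eval_zero, coeff_derivative] at hsum
  have hcoeff : p.coeff 1 = (q.roots.map fun z => (1 / (0 - z)).re).sum := by
    have := congrArg Complex.reAddGroupHom hsum
    rw [map_multiset_sum, Multiset.map_map] at this
    simpa [hq] using this
  have hterm : ∀ z ∈ q.roots, ∃ b : ℝ, 0 < b ∧ a ≤ b ∧ (1 / (0 - z)).re = 1 / b := by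
    intro z hz
    have hz := (mem_roots hqne).1 hz
    obtain ⟨r, hr, rfl⟩ := hneg z hz
    have hpr : p.eval r = 0 := by
      have : q.eval (algebraMap ℝ ℂ r) = 0 := hz
      rw [hq, eval_map_algebraMap, aeval_algebraMap_apply] at this
      simpa using this
    refine ⟨-r, by linarith, hmin _ (by linarith) (by simpa using hpr), ?_⟩
    have : (1 / (0 - (r : ℂ))) = ((1 / -r : ℝ) : ℂ) := by push_cast; ring
    rw [this, Complex.ofReal_re]
  rw [hcoeff]
  constructor
  · refine Multiset.single_le_sum ?_ _ ?_
    · intro y hy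
      obtain ⟨z, hz, rfl⟩ := Multiset.mem_map.1 hy
      obtain ⟨b, hb, -, he⟩ := hterm z hz
      rw [he]
      positivity
    · refine Multiset.mem_map.2 ⟨((-a : ℝ) : ℂ), (mem_roots hqne).2 ?_, ?_⟩
      · change q.eval (algebraMap ℝ ℂ (-a)) = 0
        rw [hq, eval_map_algebraMap, aeval_algebraMap_apply]
        simpa using hroot
      · rw [show (1 / (0 - ((-a : ℝ) : ℂ))) = ((1 / a : ℝ) : ℂ) by push_cast; ring,
          Complex.ofReal_re]
  · refine (Multiset.sum_le_card_nsmul _ (1 / a) ?_).trans ?_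
    · intro y hy
      obtain ⟨z, hz, rfl⟩ := Multiset.mem_map.1 hy
      obtain ⟨b, hb, hab, he⟩ := hterm z hz
      rw [he]
      exact one_div_le_one_div_of_le ha hab
    · rw [Multiset.card_map, nsmul_eq_mul, ← hsplits.natDegree_eq_card_roots, hq,
        natDegree_map]

lemma four_mul_le_four_pow {n : ℕ} (hn : 2 ≤ n) : 4 * n ≤ 4 ^ n := by
  induction n, hn using Nat.le_induction with
  | base => norm_num
  | succ n hn ih => rw [pow_succ]; omega

lemma coeff_one_eulerianA_bounds {n : ℕ} (hn : 2 ≤ n) :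
    (4 : ℝ) ^ n ≤ 4 * n * (eulerianA (2 * n)).coeff 1 ∧
      (eulerianA (2 * n)).coeff 1 ≤ 2 * n * 4 ^ n := by
  rw [coeff_eulerianA (by omega)]
  have hup := eulerianCount_one_le (2 * n)
  rw [pow_mul] at hup
  have hlow := choose_le_eulerianCount n n
  rw [← two_mul, eulerianCount_zero_right, ← Nat.centralBinom_eq_two_mul_choose] at hlow
  have hc := Nat.four_pow_le_two_mul_self_mul_centralBinom n (by omega)
  have h4 := four_mul_le_four_pow hn
  have hlow' : 4 ^ n ≤ 4 * n * eulerianCount (2 * n) 1 := by nlinarith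
  norm_num at hup
  exact ⟨mod_cast hlow', mod_cast hup⟩

lemma abs_log_one_sub_sq_le {n : ℕ} (hn : 2 ≤ n) {a : ℝ} (ha : 0 < a)
    (hlow : 4 ^ n ≤ 8 * (n : ℝ) ^ 2 * (1 / a)) (hup : 1 / a ≤ 2 * n * 4 ^ n) :
    |Real.log (1 - ((1 - a) / (1 + a)) ^ 2) + n * Real.log 4| ≤ 100 + 10 * Real.log n := by
  have hn0 : (0 : ℝ) < n := by positivity
  have hn2 : (2 : ℝ) ≤ n := mod_cast hn
  have hx : 1 - ((1 - a) / (1 + a)) ^ 2 = 4 * a / (1 + a) ^ 2 := by field_simp; ring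
  have hlogx : Real.log (1 - ((1 - a) / (1 + a)) ^ 2)
      = Real.log 4 + Real.log a - 2 * Real.log (1 + a) := by
    rw [hx, Real.log_div (by positivity) (by positivity), Real.log_mul (by norm_num) ha.ne',
      Real.log_pow]
    norm_num
  have h1 := Real.log_le_log (by positivity) hlow
  have h2 := Real.log_le_log (by positivity) hup
  rw [Real.log_mul (by positivity) (by positivity), Real.log_mul (by positivity) (by positivity),
    Real.log_pow, Real.log_pow, one_div, Real.log_inv] at h1
  rw [Real.log_mul (by positivity) (by positivity), Real.log_mul (by positivity) (by positivity),
    Real.log_pow, one_div, Real.log_inv] at h2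
  have ha' : 1 + a ≤ 9 * (n : ℝ) ^ 2 := by
    have h4 : (1 : ℝ) ≤ 4 ^ n := one_le_pow₀ (by norm_num)
    have := h4.trans hlow
    rw [mul_one_div, le_div_iff₀ ha] at this
    nlinarith
  have h3 : 0 ≤ Real.log (1 + a) := Real.log_nonneg (by linarith)
  have h4 := Real.log_le_log (by positivity) ha'
  rw [Real.log_mul (by positivity) (by positivity), Real.log_pow] at h4
  have hlogn : 0 ≤ Real.log n := Real.log_nonneg (by linarith)
  have l2 := Real.log_le_sub_one_of_pos (x := 2) (by norm_num)
  have l4 := Real.log_le_sub_one_of_pos (x := 4) (by norm_num)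
  have l8 := Real.log_le_sub_one_of_pos (x := 8) (by norm_num)
  have l9 := Real.log_le_sub_one_of_pos (x := 9) (by norm_num)
  have l4' : 0 ≤ Real.log 4 := Real.log_nonneg (by norm_num)
  push_cast at h1 h2 h4
  rw [hlogx, abs_le]
  constructor <;> linarith

lemma tendsto_const_add_mul_log_div_sub_one (c d : ℝ) :
    Tendsto (fun n : ℕ => (c + d * Real.log n) / ((n : ℝ) - 1)) atTop (nhds 0) := by
  have hsub : Tendsto (fun n : ℕ => (n : ℝ) - 1) atTop atTop :=
    tendsto_atTop_add_const_right _ _ tendsto_natCast_atTop_atTop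
  have hlog : Tendsto (fun n : ℕ => Real.log n / (1 * (n : ℝ) + (-1))) atTop (nhds 0) := by
    have := (Real.tendsto_pow_log_div_mul_add_atTop 1 (-1) 1 one_ne_zero).comp
      (tendsto_natCast_atTop_atTop (R := ℝ))
    simpa [Function.comp_def] using this
  have := (hsub.const_div_atTop c).add (hlog.const_mul d)
  simp only [mul_zero, add_zero] at this
  refine this.congr fun n => ?_
  rw [one_mul, ← sub_eq_add_neg]
  ring

/-- Right edge rate, type A / Λ case: If for each `n ≥ 2`, `−a_n` is the
negative zero of `A_{2n}` closest to the origin, all complex roots of `A_{2n}` being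
negative reals, and `x_n := ((1 − a_n)/(1 + a_n))²`, then
`(1/(n−1)) · log(1 − x_n) → −log 4`. -/
theorem stmt_14 (a : ℕ → ℝ)
    (hpos : ∀ n, 2 ≤ n → 0 < a n)
    (hroot : ∀ n, 2 ≤ n → (eulerianA (2 * n)).eval (-(a n)) = 0)
    (hmin : ∀ n, 2 ≤ n → ∀ b : ℝ, 0 < b → (eulerianA (2 * n)).eval (-b) = 0 → a n ≤ b)
    (hneg : ∀ n, 2 ≤ n → ∀ z : ℂ,
      ((eulerianA (2 * n)).map (algebraMap ℝ ℂ)).IsRoot z → ∃ r : ℝ, r < 0 ∧ z = (r : ℂ))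
    (x : ℕ → ℝ) (hx : ∀ n, x n = ((1 - a n) / (1 + a n)) ^ 2) :
    Tendsto (fun n : ℕ => (1 / ((n : ℝ) - 1)) * Real.log (1 - x n)) atTop
      (nhds (-Real.log 4)) := by
  have hbound : ∀ᶠ n : ℕ in atTop, ‖(1 / ((n : ℝ) - 1)) * Real.log (1 - x n) - (-Real.log 4)‖
      ≤ (104 + 10 * Real.log n) / ((n : ℝ) - 1) := by
    filter_upwards [eventually_ge_atTop 2] with n hn
    have hn2 : (2 : ℝ) ≤ n := mod_cast hn
    have h0 : (eulerianA (2 * n)).coeff 0 = 1 := by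
      rw [coeff_eulerianA (by omega), eulerianCount_zero_right, Nat.cast_one]
    obtain ⟨h1, h2⟩ := one_div_le_coeff_one_and_coeff_one_le h0 (hneg n hn) (hpos n hn)
      (hroot n hn) (hmin n hn)
    obtain ⟨h3, h4⟩ := coeff_one_eulerianA_bounds hn
    have hdeg : ((eulerianA (2 * n)).natDegree : ℝ) ≤ 2 * n :=
      mod_cast natDegree_eulerianA_le (2 * n)
    have ha : 0 < 1 / a n := one_div_pos.2 (hpos n hn)
    have h5 : (eulerianA (2 * n)).coeff 1 ≤ 2 * n * (1 / a n) :=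
      h2.trans (mul_le_mul_of_nonneg_right hdeg ha.le)
    have hlow : (4 : ℝ) ^ n ≤ 8 * (n : ℝ) ^ 2 * (1 / a n) := by
      refine h3.trans ((mul_le_mul_of_nonneg_left h5 (by positivity)).trans_eq (by ring))
    have key := abs_log_one_sub_sq_le hn (hpos n hn) hlow (h1.trans h4)
    rw [← hx n] at key
    have hn1 : (0 : ℝ) < n - 1 := by linarith
    have l4 := Real.log_le_sub_one_of_pos (x := 4) (by norm_num)
    have l4' : 0 ≤ Real.log 4 := Real.log_nonneg (by norm_num)
    have heq : (1 / ((n : ℝ) - 1)) * Real.log (1 - x n) - (-Real.log 4)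
        = (Real.log (1 - x n) + n * Real.log 4 - Real.log 4) / ((n : ℝ) - 1) := by
      field_simp
      ring
    rw [heq, Real.norm_eq_abs, abs_div, abs_of_pos hn1]
    refine div_le_div_of_nonneg_right ?_ hn1.le
    rw [abs_le] at key ⊢
    constructor <;> linarith [key.1, key.2]
  rw [tendsto_iff_norm_sub_tendsto_zero]
  exact squeeze_zero' (Eventually.of_forall fun _ => norm_nonneg _) hbound
    (tendsto_const_add_mul_log_div_sub_one 104 10)
end

section
/- (Right edge rate, type B / Ξ case.) For each n ≥ 2 let B_{2n−1} be a real polynomial satisfying the formal power series identity (B_{2n−1} viewed as a power series) = (1 − X)^{2n} · ∑_{k≥0} (2k+1)^{2n−1} X^k. Suppose there exists b_n > 0 with B_{2n−1}(−b_n) = 0, b_n ≤ b for every b > 0 with B_{2n−1}(−b) = 0, and such that every complex root of B_{2n−1} is a negative real number. Define x_n := ((1 − b_n)/(1 + b_n))². Then (1/(n−1)) · log(1 − x_n) → −log 9 as n → ∞. -/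
open Polynomial Filter

theorem PowerSeries.coeff_succ_one_sub_X_mul {R : Type*} [CommRing R] (F : PowerSeries R) (k : ℕ) :
    PowerSeries.coeff (k + 1) ((1 - PowerSeries.X) * F) =
      PowerSeries.coeff (k + 1) F - PowerSeries.coeff k F := by
  rw [sub_mul, one_mul, map_sub, PowerSeries.coeff_succ_X_mul]

/-- Multiplication by `(1 - X) ^ d` takes `d`-fold forward differences of the coefficients. -/
theorem PowerSeries.coeff_one_sub_X_pow_mul_mk {R : Type*} [CommRing R] (f : R → R) (d k : ℕ) :
    PowerSeries.coeff (k + d)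
      ((1 - PowerSeries.X) ^ d * PowerSeries.mk (fun j : ℕ => f j)) =
      (fwdDiff (1 : R))^[d] f k := by
  induction d generalizing k with
  | zero => simp
  | succ d ih =>
    rw [pow_succ', mul_assoc, ← add_assoc, PowerSeries.coeff_succ_one_sub_X_mul, ih,
      show k + d + 1 = (k + 1) + d by ring, ih, Function.iterate_succ_apply', fwdDiff]
    push_cast
    rfl

theorem PowerSeries.coeff_zero_one_sub_X_pow_mul {R : Type*} [CommRing R] (F : PowerSeries R)
    (d : ℕ) :
    PowerSeries.coeff 0 ((1 - PowerSeries.X) ^ d * F) = PowerSeries.coeff 0 F := by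
  simp

theorem PowerSeries.coeff_one_one_sub_X_pow_mul {R : Type*} [CommRing R] (F : PowerSeries R)
    (d : ℕ) :
    PowerSeries.coeff 1 ((1 - PowerSeries.X) ^ d * F) =
      PowerSeries.coeff 1 F - d * PowerSeries.coeff 0 F := by
  induction d with
  | zero => simp
  | succ d ih =>
    have h := PowerSeries.coeff_succ_one_sub_X_mul ((1 - PowerSeries.X) ^ d * F) 0
    rw [zero_add, ih, PowerSeries.coeff_zero_one_sub_X_pow_mul] at h
    rw [pow_succ', mul_assoc, h]
    push_cast
    ring

/-- For a real-rooted polynomial with negative roots, constant coefficient `1` and root `-b` closest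
to the origin, the linear coefficient is between `1 / b` and `natDegree / b`. -/
theorem Polynomial.coeff_one_bounds_of_neg_roots {p : ℝ[X]} {b : ℝ} (h0 : p.coeff 0 = 1)
    (hb : 0 < b) (hroot : p.eval (-b) = 0)
    (hmin : ∀ c : ℝ, 0 < c → p.eval (-c) = 0 → b ≤ c)
    (hneg : ∀ z : ℂ, (p.map (algebraMap ℝ ℂ)).IsRoot z → ∃ r : ℝ, r < 0 ∧ z = (r : ℂ)) :
    1 / b ≤ p.coeff 1 ∧ p.coeff 1 ≤ p.natDegree / b := by
  have hp : p ≠ 0 := by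
    rintro rfl
    simp at h0
  have hsplit : p.Splits := by
    refine Polynomial.Splits.of_splits_map (algebraMap ℝ ℂ) (IsAlgClosed.splits _) ?_
    intro z hz
    obtain ⟨r, -, rfl⟩ := hneg z (Polynomial.isRoot_of_mem_roots hz)
    exact ⟨r, rfl⟩
  have hev : p.eval 0 = 1 := by rw [← Polynomial.coeff_zero_eq_eval_zero, h0]
  have hsum := hsplit.eval_derivative_div_eval_of_ne_zero (x := 0) (by rw [hev]; exact one_ne_zero)
  rw [hev, div_one, ← Polynomial.coeff_zero_eq_eval_zero, Polynomial.coeff_derivative] at hsum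
  have hterm : ∀ r ∈ p.roots, 0 ≤ 1 / (0 - r) ∧ 1 / (0 - r) ≤ 1 / b := by
    intro r hr
    have hr' : p.eval r = 0 := Polynomial.isRoot_of_mem_roots hr
    obtain ⟨s, hs, hrs⟩ := hneg r (by
      simpa using (show p.IsRoot r from hr').map (f := algebraMap ℝ ℂ))
    have hr0 : r < 0 := by
      have : r = s := by exact_mod_cast hrs
      rwa [this]
    have hle := hmin (-r) (by linarith) (by rwa [neg_neg])
    rw [zero_sub]
    exact ⟨(one_div_pos.2 (neg_pos.2 hr0)).le, one_div_le_one_div_of_le hb hle⟩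
  have hcoeff : p.coeff 1 = (p.roots.map fun z ↦ 1 / (0 - z)).sum := by
    rw [← hsum]; norm_num
  rw [hcoeff]
  constructor
  · have := Multiset.single_le_sum (s := p.roots.map fun z ↦ 1 / (0 - z))
      (by
        intro y hy
        obtain ⟨r, hr, rfl⟩ := Multiset.mem_map.1 hy
        exact (hterm r hr).1) (1 / (0 - -b))
      (Multiset.mem_map_of_mem _ ((Polynomial.mem_roots hp).2 hroot))
    simpa using this
  · have := Multiset.sum_le_card_nsmul (p.roots.map fun z ↦ 1 / (0 - z)) (1 / b)
      (by
        intro y hy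
        obtain ⟨r, hr, rfl⟩ := Multiset.mem_map.1 hy
        exact (hterm r hr).2)
    rw [Multiset.card_map, nsmul_eq_mul, mul_one_div] at this
    refine this.trans ?_
    gcongr
    exact_mod_cast Polynomial.card_roots' p

/-- The type-B Eulerian polynomial `B_m` has degree less than `m + 1`. -/
theorem Polynomial.natDegree_lt_of_coe_eq_one_sub_X_pow_mul {p : ℝ[X]} {m : ℕ}
    (hp : (p : PowerSeries ℝ) = (1 - PowerSeries.X) ^ (m + 1) *
      PowerSeries.mk (fun k : ℕ => (2 * k + 1 : ℝ) ^ m)) :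
    p.natDegree < m + 1 := by
  rw [Nat.lt_succ_iff, Polynomial.natDegree_le_iff_coeff_eq_zero]
  intro N hN
  obtain ⟨k, rfl⟩ := Nat.exists_eq_add_of_le' (Nat.succ_le_of_lt hN)
  have hdeg : ((2 * X + 1 : ℝ[X]) ^ m).natDegree < m + 1 := by
    refine Nat.lt_succ_of_le ?_
    compute_degree
  have h := PowerSeries.coeff_one_sub_X_pow_mul_mk (((2 * X + 1 : ℝ[X]) ^ m).eval) (m + 1) k
  rw [Polynomial.fwdDiff_iter_eq_zero_of_degree_lt hdeg] at h
  rw [← Polynomial.coeff_coe, hp]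
  simpa using h

theorem four_mul_le_three_pow {n : ℕ} (hn : 2 ≤ n) : 4 * (n : ℝ) ≤ 3 ^ (2 * n - 1) := by
  obtain ⟨k, rfl⟩ := Nat.exists_eq_add_of_le' hn
  rw [show 2 * (k + 2) - 1 = 2 * k + 3 by omega, pow_add, pow_mul]
  have h := one_add_mul_le_pow (a := (8 : ℝ)) (by norm_num) k
  push_cast
  norm_num at h ⊢
  linarith [k.cast_nonneg (α := ℝ)]

theorem one_sub_edge_bounds {p : ℝ[X]} {b : ℝ} {n : ℕ} (hn : 2 ≤ n)
    (hp : (p : PowerSeries ℝ) = (1 - PowerSeries.X) ^ (2 * n) *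
      PowerSeries.mk (fun k : ℕ => (2 * k + 1 : ℝ) ^ (2 * n - 1)))
    (hb : 0 < b) (hroot : p.eval (-b) = 0)
    (hmin : ∀ c : ℝ, 0 < c → p.eval (-c) = 0 → b ≤ c)
    (hneg : ∀ z : ℂ, (p.map (algebraMap ℝ ℂ)).IsRoot z → ∃ r : ℝ, r < 0 ∧ z = (r : ℂ)) :
    1 / 3 ^ (2 * n - 1) ≤ 1 - ((1 - b) / (1 + b)) ^ 2 ∧
      1 - ((1 - b) / (1 + b)) ^ 2 ≤ 16 * n / 3 ^ (2 * n - 1) := by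
  have h0 : p.coeff 0 = 1 := by
    rw [← Polynomial.coeff_coe, hp, PowerSeries.coeff_zero_one_sub_X_pow_mul]
    simp
  have h1 : p.coeff 1 = 3 ^ (2 * n - 1) - 2 * n := by
    rw [← Polynomial.coeff_coe, hp, PowerSeries.coeff_one_one_sub_X_pow_mul]
    norm_num
  have hdeg : p.natDegree < 2 * n := by
    have := Polynomial.natDegree_lt_of_coe_eq_one_sub_X_pow_mul (p := p) (m := 2 * n - 1)
      (by rw [hp, Nat.sub_add_cancel (by omega)])
    omega
  have hdeg' : (p.natDegree : ℝ) ≤ 2 * n := by exact_mod_cast hdeg.le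
  obtain ⟨hlo, hhi⟩ := Polynomial.coeff_one_bounds_of_neg_roots h0 hb hroot hmin hneg
  have h3 := four_mul_le_three_pow hn
  rw [h1] at hlo hhi
  have hn0 : (0 : ℝ) ≤ n := n.cast_nonneg
  have hM : (0 : ℝ) < 3 ^ (2 * n - 1) := by positivity
  generalize (3 : ℝ) ^ (2 * n - 1) = M at *
  rw [div_le_iff₀ hb] at hlo
  rw [le_div_iff₀ hb] at hhi
  have hbM : 1 ≤ b * M := by nlinarith
  have hbn : b * M ≤ 4 * n := by nlinarith
  have hb1 : b ≤ 1 := by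
    by_contra! h
    nlinarith
  have hx : 1 - ((1 - b) / (1 + b)) ^ 2 = 4 * b / (1 + b) ^ 2 := by
    field_simp
    ring
  rw [hx, div_le_div_iff₀ hM (by positivity), div_le_div_iff₀ (by positivity) hM]
  constructor
  · nlinarith
  · nlinarith [mul_nonneg hn0 hb.le, mul_nonneg hn0 (sq_nonneg b)]

/-- Right edge rate, type B / Ξ case: For each `n ≥ 2` let `B_{2n−1}` be
the real polynomial with `(B_{2n−1} : ℝ⟦X⟧) = (1 − X)^{2n} · ∑_{k≥0} (2k+1)^{2n−1} X^k`.
If `−b_n` is its negative zero closest to the origin, all complex roots being negative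
reals, and `x_n := ((1 − b_n)/(1 + b_n))²`, then `(1/(n−1)) · log(1 − x_n) → −log 9`. -/
theorem stmt_15 (B : ℕ → Polynomial ℝ) (b : ℕ → ℝ)
    (hB : ∀ n, 2 ≤ n → (↑(B n) : PowerSeries ℝ) =
      (1 - PowerSeries.X) ^ (2 * n) *
        PowerSeries.mk (fun k : ℕ => ((2 * k + 1 : ℝ)) ^ (2 * n - 1)))
    (hpos : ∀ n, 2 ≤ n → 0 < b n)
    (hroot : ∀ n, 2 ≤ n → (B n).eval (-(b n)) = 0)
    (hmin : ∀ n, 2 ≤ n → ∀ c : ℝ, 0 < c → (B n).eval (-c) = 0 → b n ≤ c)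
    (hneg : ∀ n, 2 ≤ n → ∀ z : ℂ,
      ((B n).map (algebraMap ℝ ℂ)).IsRoot z → ∃ r : ℝ, r < 0 ∧ z = (r : ℂ))
    (x : ℕ → ℝ) (hx : ∀ n, x n = ((1 - b n) / (1 + b n)) ^ 2) :
    Tendsto (fun n : ℕ => (1 / ((n : ℝ) - 1)) * Real.log (1 - x n)) atTop
      (nhds (-Real.log 9)) := by
  have hinv : Tendsto (fun n : ℕ => 1 / ((n : ℝ) - 1)) atTop (nhds 0) := by
    simpa [sub_eq_add_neg, Pi.inv_def] using (tendsto_atTop_add_const_right atTop (-1 : ℝ)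
      tendsto_natCast_atTop_atTop).inv_tendsto_atTop
  have hlog : Tendsto (fun n : ℕ => Real.log n / ((n : ℝ) - 1)) atTop (nhds 0) := by
    have h := (Real.tendsto_pow_log_div_mul_add_atTop 1 (-1) 1 one_ne_zero).comp
      tendsto_natCast_atTop_atTop
    simpa [Function.comp_def, sub_eq_add_neg] using h
  have hlower : Tendsto (fun n : ℕ => -Real.log 9 - Real.log 3 * (1 / ((n : ℝ) - 1)))
      atTop (nhds (-Real.log 9)) := by
    simpa using (hinv.const_mul (Real.log 3)).const_sub (-Real.log 9)
  have hupper : Tendsto (fun n : ℕ => -Real.log 9 +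
      ((Real.log 16 - Real.log 3) * (1 / ((n : ℝ) - 1)) + Real.log n / ((n : ℝ) - 1)))
      atTop (nhds (-Real.log 9)) := by
    simpa using ((hinv.const_mul (Real.log 16 - Real.log 3)).add hlog).const_add (-Real.log 9)
  have key : ∀ n : ℕ, 2 ≤ n →
      -Real.log 9 - Real.log 3 * (1 / ((n : ℝ) - 1)) ≤
        (1 / ((n : ℝ) - 1)) * Real.log (1 - x n) ∧
      (1 / ((n : ℝ) - 1)) * Real.log (1 - x n) ≤ -Real.log 9 +
        ((Real.log 16 - Real.log 3) * (1 / ((n : ℝ) - 1)) + Real.log n / ((n : ℝ) - 1)) := by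
    intro n hn
    obtain ⟨hlo, hhi⟩ := one_sub_edge_bounds hn (hB n hn) (hpos n hn) (hroot n hn) (hmin n hn)
      (hneg n hn)
    rw [← hx n] at hlo hhi
    have hn2 : (2 : ℝ) ≤ n := by exact_mod_cast hn
    have hn1 : (0 : ℝ) < n - 1 := by linarith
    have hM : (0 : ℝ) < 3 ^ (2 * n - 1) := by positivity
    have hlogM : Real.log (3 ^ (2 * n - 1)) = ((n : ℝ) - 1) * Real.log 9 + Real.log 3 := by
      rw [show (9 : ℝ) = 3 ^ 2 by norm_num, Real.log_pow, Real.log_pow,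
        Nat.cast_sub (by omega)]
      push_cast
      ring
    have hxpos : 0 < 1 - x n := lt_of_lt_of_le (by positivity) hlo
    have h1 := Real.log_le_log (by positivity) hlo
    have h2 := Real.log_le_log hxpos hhi
    rw [one_div, Real.log_inv, hlogM] at h1
    rw [Real.log_div (by positivity) hM.ne', Real.log_mul (by norm_num) (by positivity),
      hlogM] at h2
    constructor
    · rw [one_div_mul_eq_div, le_div_iff₀ hn1]
      field_simp
      linarith
    · rw [one_div_mul_eq_div, div_le_iff₀ hn1]
      field_simp
      linarith
  exact tendsto_of_tendsto_of_tendsto_of_le_of_le' hlower hupper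
    (eventually_atTop.2 ⟨2, fun n hn => (key n hn).1⟩)
    (eventually_atTop.2 ⟨2, fun n hn => (key n hn).2⟩)
end
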